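/- arXiv:2503.09034 — 3 statements merged into one kernel-verified Lean document; each statement's English description precedes it below -/
import Mathlib

section
/- Let p be a prime. The natural ring homomorphism from ℤ_p[[X]] to the inverse limit over even n of ℤ_p[[X]]/(X·ω_n^+(1+X)) (transition maps the natural projections, noting X·ω_{n-2}^+(1+X) divides X·ω_n^+(1+X)) is an isomorphism; likewise, the natural ring homomorphism from ℤ_p[[X]] to the inverse limit over odd n of ℤ_p[[X]]/(ω_n^-(1+X)) is an isomorphism. -/
open Polynomial

/-- The "plus" part `ω_n⁺(X) = ∏_{1 ≤ k ≤ n, k even} Φ_{p^k}(X)`. -/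
noncomputable def omegaPlus (p n : ℕ) : Polynomial ℤ :=
  ∏ k ∈ (Finset.Icc 1 n).filter (fun k => Even k), Polynomial.cyclotomic (p ^ k) ℤ

/-- The "minus" part `ω_n⁻(X) = (X-1) ∏_{1 ≤ k ≤ n, k odd} Φ_{p^k}(X)`. -/
noncomputable def omegaMinus (p n : ℕ) : Polynomial ℤ :=
  (Polynomial.X - 1) *
    ∏ k ∈ (Finset.Icc 1 n).filter (fun k => Odd k), Polynomial.cyclotomic (p ^ k) ℤ

/-- The ideal `(X · ω_{2m}⁺(1+X))` of `ℤ_p[[X]]`. -/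
noncomputable def Iplus (p : ℕ) [Fact p.Prime] (m : ℕ) : Ideal (PowerSeries ℤ_[p]) :=
  Ideal.span {PowerSeries.X *
    (((omegaPlus p (2 * m)).comp (1 + Polynomial.X)).map (Int.castRingHom ℤ_[p]) :
      PowerSeries ℤ_[p])}

/-- The ideal `(ω_{2m+1}⁻(1+X))` of `ℤ_p[[X]]`. -/
noncomputable def Iminus (p : ℕ) [Fact p.Prime] (m : ℕ) : Ideal (PowerSeries ℤ_[p]) :=
  Ideal.span {(((omegaMinus p (2 * m + 1)).comp (1 + Polynomial.X)).map
      (Int.castRingHom ℤ_[p]) : PowerSeries ℤ_[p])}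

open scoped PowerSeries.WithPiTopology in
theorem limit_aux (p : ℕ) [Fact p.Prime] (I : ℕ → Ideal (PowerSeries ℤ_[p]))
    (g a : ℕ → PowerSeries ℤ_[p]) (hI : ∀ m, I m = Ideal.span {g m})
    (hg : ∀ m, g (m + 1) = g m * a m)
    (ha : ∀ m, ¬ IsUnit (PowerSeries.constantCoeff (a m))) :
    Function.Injective
        (fun (f : PowerSeries ℤ_[p]) (m : ℕ) => Ideal.Quotient.mk (I m) f) ∧
      Set.range (fun (f : PowerSeries ℤ_[p]) (m : ℕ) => Ideal.Quotient.mk (I m) f)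
        = {s | ∀ m : ℕ, ∃ x : PowerSeries ℤ_[p],
            Ideal.Quotient.mk (I m) x = s m ∧
            Ideal.Quotient.mk (I (m + 1)) x = s (m + 1)} := by
  have hle : ∀ m, I (m + 1) ≤ I m := by
    intro m
    rw [hI, hI, hg, Ideal.span_singleton_le_span_singleton]
    exact dvd_mul_right _ _
  constructor
  · intro f f' h
    have hloc : IsLocalRing (PowerSeries ℤ_[p]) :=
      inferInstanceAs (IsLocalRing (MvPowerSeries Unit ℤ_[p]))
    set M := IsLocalRing.maximalIdeal (PowerSeries ℤ_[p]) with hM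
    have haM : ∀ m, a m ∈ M := by
      intro m
      rw [hM, IsLocalRing.mem_maximalIdeal, mem_nonunits_iff]
      exact fun hu => ha m (hu.map _)
    have hgM : ∀ m, g m ∈ M ^ m := by
      intro m
      induction m with
      | zero => simp
      | succ m ih => rw [hg, pow_succ]; exact Ideal.mul_mem_mul ih (haM m)
    have key : f - f' ∈ (⨅ i : ℕ, M ^ i) := by
      rw [Ideal.mem_iInf]
      intro m
      have h1 : f - f' ∈ I m := Ideal.Quotient.eq.mp (congrFun h m)
      rw [hI] at h1
      exact (Ideal.span_singleton_le_iff_mem _).mpr (hgM m) h1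
    rw [Ideal.iInf_pow_eq_bot_of_isLocalRing M Ideal.IsPrime.ne_top'] at key
    exact sub_eq_zero.mp key
  · ext s
    constructor
    · rintro ⟨f, rfl⟩ m
      exact ⟨f, rfl, rfl⟩
    · intro hs
      choose x hx hx' using hs
      have hc : CompactSpace (PowerSeries ℤ_[p]) :=
        inferInstanceAs (CompactSpace ((Unit →₀ ℕ) → ℤ_[p]))
      let t : ℕ → Set (PowerSeries ℤ_[p]) := fun m => {y | Ideal.Quotient.mk (I m) y = s m}
      have ht : ∀ m, t m = (fun z => x m + g m * z) '' Set.univ := by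
        intro m
        ext y
        simp only [t, Set.mem_setOf_eq, Set.image_univ, Set.mem_range]
        rw [← hx m, Ideal.Quotient.eq, hI, Ideal.mem_span_singleton]
        constructor
        · rintro ⟨z, hz⟩
          exact ⟨z, by rw [← hz]; ring⟩
        · rintro ⟨z, rfl⟩
          exact ⟨z, by ring⟩
      have hcl : ∀ m, IsClosed (t m) := by
        intro m
        rw [ht]
        exact (isCompact_univ.image
          (continuous_const.add (continuous_const.mul continuous_id))).isClosed
      obtain ⟨y, hy⟩ := IsCompact.nonempty_iInter_of_sequence_nonempty_isCompact_isClosed t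
        (by
          intro m y hy
          have h1 : Ideal.Quotient.mk (I (m + 1)) y = s (m + 1) := hy
          change Ideal.Quotient.mk (I m) y = s m
          rw [← hx' m, Ideal.Quotient.eq] at h1
          rw [← hx m, Ideal.Quotient.eq]
          exact hle m h1)
        (fun m => ⟨x m, hx m⟩) (hcl 0).isCompact hcl
      exact ⟨y, funext fun m => Set.mem_iInter.mp hy m⟩

theorem cyclo_nonunit (p : ℕ) [Fact p.Prime] (k : ℕ) :
    ¬ IsUnit (PowerSeries.constantCoeff
      ((((cyclotomic (p ^ (k + 1)) ℤ).comp (1 + X)).map (Int.castRingHom ℤ_[p]) :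
        Polynomial ℤ_[p]) : PowerSeries ℤ_[p])) := by
  have : PowerSeries.constantCoeff
      ((((cyclotomic (p ^ (k + 1)) ℤ).comp (1 + X)).map (Int.castRingHom ℤ_[p]) :
        Polynomial ℤ_[p]) : PowerSeries ℤ_[p]) = (p : ℤ_[p]) := by
    rw [Polynomial.constantCoeff_coe, Polynomial.coeff_map, Polynomial.coeff_zero_eq_eval_zero,
      Polynomial.eval_comp]
    simp [eval_one_cyclotomic_prime_pow]
  rw [this]
  exact PadicInt.prime_p.not_unit

theorem omegaPlus_succ (p m : ℕ) :
    omegaPlus p (2 * (m + 1)) = omegaPlus p (2 * m) * cyclotomic (p ^ (2 * m + 1 + 1)) ℤ := by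
  unfold omegaPlus
  have : (Finset.Icc 1 (2 * (m + 1))).filter (fun k => Even k)
      = insert (2 * m + 1 + 1) ((Finset.Icc 1 (2 * m)).filter (fun k => Even k)) := by
    ext k
    simp only [Finset.mem_filter, Finset.mem_Icc, Finset.mem_insert]
    grind
  rw [this, Finset.prod_insert (by simp), mul_comm]

theorem omegaMinus_succ (p m : ℕ) :
    omegaMinus p (2 * (m + 1) + 1)
      = omegaMinus p (2 * m + 1) * cyclotomic (p ^ (2 * m + 2 + 1)) ℤ := by
  unfold omegaMinus
  have : (Finset.Icc 1 (2 * (m + 1) + 1)).filter (fun k => Odd k)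
      = insert (2 * m + 2 + 1) ((Finset.Icc 1 (2 * m + 1)).filter (fun k => Odd k)) := by
    ext k
    simp only [Finset.mem_filter, Finset.mem_Icc, Finset.mem_insert]
    grind
  rw [this, Finset.prod_insert (by simp)]
  ring

/-- `ℤ_p[[X]]` is the inverse limit of `ℤ_p[[X]]/(X·ω_n⁺(1+X))` over even `n`, and also of
`ℤ_p[[X]]/(ω_n⁻(1+X))` over odd `n`: the natural map to the product of the quotients is
injective and its range is exactly the set of compatible families (a family is compatible
with respect to the natural projections iff each pair of consecutive entries admits a
common lift). -/
theorem powerSeries_isomorphic_inverseLimit (p : ℕ) [Fact p.Prime] :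
    (Function.Injective
        (fun (f : PowerSeries ℤ_[p]) (m : ℕ) => Ideal.Quotient.mk (Iplus p m) f) ∧
      Set.range (fun (f : PowerSeries ℤ_[p]) (m : ℕ) => Ideal.Quotient.mk (Iplus p m) f)
        = {s | ∀ m : ℕ, ∃ x : PowerSeries ℤ_[p],
            Ideal.Quotient.mk (Iplus p m) x = s m ∧
            Ideal.Quotient.mk (Iplus p (m + 1)) x = s (m + 1)}) ∧
    (Function.Injective
        (fun (f : PowerSeries ℤ_[p]) (m : ℕ) => Ideal.Quotient.mk (Iminus p m) f) ∧
      Set.range (fun (f : PowerSeries ℤ_[p]) (m : ℕ) => Ideal.Quotient.mk (Iminus p m) f)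
        = {s | ∀ m : ℕ, ∃ x : PowerSeries ℤ_[p],
            Ideal.Quotient.mk (Iminus p m) x = s m ∧
            Ideal.Quotient.mk (Iminus p (m + 1)) x = s (m + 1)}) := by
  refine ⟨limit_aux p (Iplus p) _ _ (fun m => rfl) (fun m => ?_)
      (fun m => cyclo_nonunit p (2 * m + 1)),
    limit_aux p (Iminus p) _ _ (fun m => rfl) (fun m => ?_)
      (fun m => cyclo_nonunit p (2 * m + 2))⟩
  · rw [omegaPlus_succ, Polynomial.mul_comp, Polynomial.map_mul, Polynomial.coe_mul, mul_assoc]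
  · rw [omegaMinus_succ, Polynomial.mul_comp, Polynomial.map_mul, Polynomial.coe_mul]
end

section
/- Let p be a prime, O a commutative integral domain, n ≥ 1, and Λ_n = O[ℤ/p^nℤ] the group algebra with γ a generator of ℤ/p^nℤ. Then the annihilator of ω_n^-(γ) in Λ_n is exactly the principal ideal generated by ω_n^+(γ), and the annihilator of ω_n^+(γ) is exactly the principal ideal generated by ω_n^-(γ). Consequently multiplication by ω_n^∓(γ) induces Λ_n-module isomorphisms Λ_n/ω_n^±(γ)Λ_n ≅ ω_n^∓(γ)Λ_n. -/
open Polynomial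

theorem omega_mul (p n : ℕ) (hp : p.Prime) :
    omegaPlus p n * omegaMinus p n = X ^ (p ^ n) - 1 := by
  haveI := Fact.mk hp
  have h : omegaPlus p n * omegaMinus p n =
      (X - 1) * ∏ k ∈ Finset.Icc 1 n, Polynomial.cyclotomic (p ^ k) ℤ := by
    unfold omegaPlus omegaMinus
    rw [← Finset.prod_filter_mul_prod_filter_not (Finset.Icc 1 n) (fun k => Even k)]
    simp only [Nat.not_even_iff_odd]
    ring
  rw [h]
  clear h
  induction n with
  | zero => simp
  | succ m ih =>
    rw [Finset.prod_Icc_succ_top (by omega), ← mul_assoc, ih, mul_comm,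
      Polynomial.cyclotomic_prime_pow_mul_X_pow_sub_one]

theorem omegaPlus_monic (p n : ℕ) : (omegaPlus p n).Monic :=
  monic_prod_of_monic _ _ fun _ _ => cyclotomic.monic _ _

theorem omegaMinus_monic (p n : ℕ) : (omegaMinus p n).Monic := by
  refine Monic.mul ?_ (monic_prod_of_monic _ _ fun _ _ => cyclotomic.monic _ _)
  simpa using monic_X_sub_C (1 : ℤ)

theorem quot_equiv_span {R : Type*} [CommRing R] (u v : R)
    (h : ∀ a : R, a * v = 0 ↔ a ∈ Ideal.span {u}) :
    Nonempty ((R ⧸ Ideal.span {u}) ≃ₗ[R] (Ideal.span {v} : Ideal R)) := by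
  have hk : Ideal.span {u} = LinearMap.ker (LinearMap.toSpanSingleton R R v) := by
    ext a
    rw [← h a, LinearMap.mem_ker]
    simp
  have hr : LinearMap.range (LinearMap.toSpanSingleton R R v) = Ideal.span {v} :=
    LinearMap.range_toSpanSingleton v
  exact ⟨(Submodule.quotEquivOfEq _ _ hk).trans
    ((LinearMap.quotKerEquivRange _).trans (LinearEquiv.ofEq _ _ hr))⟩

theorem ann_of_poly {O R : Type*} [CommRing O] [IsDomain O] [CommRing R] (φ : O[X] →+* R)
    (hs : Function.Surjective φ) (U V W : O[X]) (hV : V ≠ 0) (hW : U * V = W)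
    (hk : ∀ f, φ f = 0 ↔ W ∣ f) (a : R) :
    a * φ V = 0 ↔ a ∈ Ideal.span {φ U} := by
  obtain ⟨A, rfl⟩ := hs a
  rw [← map_mul, hk, ← hW, mul_dvd_mul_iff_right hV, Ideal.mem_span_singleton]
  constructor
  · exact fun h => map_dvd φ h
  · rintro ⟨b, hb⟩
    obtain ⟨B, rfl⟩ := hs b
    have : φ (A - U * B) = 0 := by rw [map_sub, map_mul, hb, sub_self]
    have h2 : U ∣ A - U * B := (Dvd.intro _ hW).trans ((hk _).1 this)
    exact (dvd_sub_left (Dvd.intro _ rfl)).1 h2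

theorem aeval_single_eq {O : Type*} [CommRing O] {N : ℕ} (g : ZMod N) (f : O[X]) :
    Polynomial.aeval (AddMonoidAlgebra.single g (1 : O)) f =
      ∑ i ∈ f.support, AddMonoidAlgebra.single (i • g) (f.coeff i) := by
  rw [Polynomial.aeval_eq_sum_range' (Nat.lt_succ_self _), ← Polynomial.sum_over_range' f
    (f := fun i c => c • (AddMonoidAlgebra.single g (1 : O)) ^ i) (by simp) _ (Nat.lt_succ_self _),
    Polynomial.sum_def]
  refine Finset.sum_congr rfl fun i _ => ?_
  rw [AddMonoidAlgebra.single_pow]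
  simp

theorem aeval_single_surj {O : Type*} [CommRing O] {N : ℕ} [NeZero N] (g : ZMod N)
    (hg : AddSubgroup.zmultiples g = ⊤) :
    Function.Surjective (Polynomial.aeval (R := O) (AddMonoidAlgebra.single g (1 : O))) := by
  intro a
  induction a using AddMonoidAlgebra.induction_linear with
  | zero => exact ⟨0, map_zero _⟩
  | add a b ha hb =>
    obtain ⟨A, rfl⟩ := ha
    obtain ⟨B, rfl⟩ := hb
    exact ⟨A + B, map_add _ _ _⟩
  | single x c =>
    have hx : x ∈ AddSubgroup.zmultiples g := hg ▸ AddSubgroup.mem_top x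
    rw [← mem_multiples_iff_mem_zmultiples] at hx
    obtain ⟨i, rfl⟩ := hx
    refine ⟨monomial i c, ?_⟩
    rw [Polynomial.aeval_monomial, AddMonoidAlgebra.single_pow]
    simp

theorem aeval_single_ker {O : Type*} [CommRing O] [Nontrivial O] {N : ℕ} [NeZero N] (g : ZMod N)
    (hg : AddSubgroup.zmultiples g = ⊤) (f : O[X]) :
    Polynomial.aeval (AddMonoidAlgebra.single g (1 : O)) f = 0 ↔ (X ^ N - 1 : O[X]) ∣ f := by
  have hm : (X ^ N - 1 : O[X]).Monic := monic_X_pow_sub_C 1 (NeZero.ne N)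
  have hord : addOrderOf g = N := by
    rw [← Nat.card_zmultiples, hg, AddSubgroup.card_top, Nat.card_zmod]
  have h0 : Polynomial.aeval (AddMonoidAlgebra.single g (1 : O)) (X ^ N - 1 : O[X]) = 0 := by
    rw [map_sub, map_pow, Polynomial.aeval_X, AddMonoidAlgebra.single_pow, map_one]
    simp [AddMonoidAlgebra.one_def]
  constructor
  · intro h
    rw [← modByMonic_eq_zero_iff_dvd hm]
    set r := f %ₘ (X ^ N - 1 : O[X]) with hr
    have hr0 : Polynomial.aeval (AddMonoidAlgebra.single g (1 : O)) r = 0 := by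
      have := congrArg (Polynomial.aeval (AddMonoidAlgebra.single g (1 : O)))
        (modByMonic_add_div f (X ^ N - 1 : O[X]))
      rw [map_add, map_mul, h0, zero_mul, add_zero, h] at this
      exact this
    have hd : r.degree < N := by
      have := degree_modByMonic_lt f hm
      rwa [show (X ^ N - 1 : O[X]).degree = N from
        degree_X_pow_sub_C (NeZero.pos N) 1] at this
    rw [aeval_single_eq] at hr0
    ext i
    rw [coeff_zero]
    by_contra hi
    have hlt : ∀ j ∈ r.support, j < N := fun j hj => by
      have := (le_degree_of_mem_supp j hj).trans_lt hd
      exact_mod_cast this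
    have his : i ∈ r.support := mem_support_iff.2 hi
    have hc := congrArg (fun z : AddMonoidAlgebra O (ZMod N) => z.coeff (i • g)) hr0
    simp only [AddMonoidAlgebra.coeff_sum, Finsupp.finset_sum_apply,
      AddMonoidAlgebra.coeff_single] at hc
    rw [Finset.sum_eq_single i] at hc
    · simp at hc; exact hi hc
    · intro j hj hji
      rw [Finsupp.single_eq_of_ne]
      intro he
      apply hji
      refine nsmul_injOn_Iio_addOrderOf (x := g) ?_ ?_ he.symm
      · simpa [hord] using hlt j hj
      · simpa [hord] using hlt i his
    · exact fun h => absurd his h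
  · rintro ⟨q, rfl⟩
    rw [map_mul, h0, zero_mul]

/-- Over the group algebra `Λ_n = O[ℤ/p^nℤ]` of an integral domain `O`, with `γ` a
generator of `ℤ/p^nℤ`: the annihilator of `ω_n⁻(γ)` is exactly the ideal `(ω_n⁺(γ))`,
the annihilator of `ω_n⁺(γ)` is exactly `(ω_n⁻(γ))`, and consequently
`Λ_n/ω_n^±(γ)Λ_n ≅ ω_n^∓(γ)Λ_n` as `Λ_n`-modules. -/
theorem annihilator_omega (O : Type*) [CommRing O] [IsDomain O] (p n : ℕ) (hp : p.Prime)
    [NeZero p] (hn : 1 ≤ n) (g : ZMod (p ^ n)) (hg : AddSubgroup.zmultiples g = ⊤) :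
    (∀ a : AddMonoidAlgebra O (ZMod (p ^ n)),
      a * Polynomial.aeval (AddMonoidAlgebra.single g (1 : O)) (omegaMinus p n) = 0 ↔
        a ∈ Ideal.span
          {Polynomial.aeval (AddMonoidAlgebra.single g (1 : O)) (omegaPlus p n)}) ∧
    (∀ a : AddMonoidAlgebra O (ZMod (p ^ n)),
      a * Polynomial.aeval (AddMonoidAlgebra.single g (1 : O)) (omegaPlus p n) = 0 ↔
        a ∈ Ideal.span
          {Polynomial.aeval (AddMonoidAlgebra.single g (1 : O)) (omegaMinus p n)}) ∧
    Nonempty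
      ((AddMonoidAlgebra O (ZMod (p ^ n)) ⧸
          Ideal.span
            {Polynomial.aeval (AddMonoidAlgebra.single g (1 : O)) (omegaPlus p n)})
        ≃ₗ[AddMonoidAlgebra O (ZMod (p ^ n))]
        (Ideal.span
          {Polynomial.aeval (AddMonoidAlgebra.single g (1 : O)) (omegaMinus p n)} :
            Ideal (AddMonoidAlgebra O (ZMod (p ^ n))))) ∧
    Nonempty
      ((AddMonoidAlgebra O (ZMod (p ^ n)) ⧸
          Ideal.span
            {Polynomial.aeval (AddMonoidAlgebra.single g (1 : O)) (omegaMinus p n)})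
        ≃ₗ[AddMonoidAlgebra O (ZMod (p ^ n))]
        (Ideal.span
          {Polynomial.aeval (AddMonoidAlgebra.single g (1 : O)) (omegaPlus p n)} :
            Ideal (AddMonoidAlgebra O (ZMod (p ^ n))))) := by
  haveI : NeZero (p ^ n) := ⟨pow_ne_zero _ hp.ne_zero⟩
  have key : ∀ P : ℤ[X], Polynomial.aeval (AddMonoidAlgebra.single g (1 : O)) P =
      (Polynomial.aeval (R := O) (AddMonoidAlgebra.single g (1 : O))).toRingHom
        (P.map (algebraMap ℤ O)) := fun P => by
    exact (Polynomial.aeval_map_algebraMap O _ P).symm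
  have hW : (omegaPlus p n).map (algebraMap ℤ O) * (omegaMinus p n).map (algebraMap ℤ O) =
      X ^ (p ^ n) - 1 := by
    rw [← Polynomial.map_mul, omega_mul p n hp]
    simp
  have h1 : ∀ a : AddMonoidAlgebra O (ZMod (p ^ n)),
      a * Polynomial.aeval (AddMonoidAlgebra.single g (1 : O)) (omegaMinus p n) = 0 ↔
        a ∈ Ideal.span
          {Polynomial.aeval (AddMonoidAlgebra.single g (1 : O)) (omegaPlus p n)} := by
    rw [key, key]
    exact ann_of_poly _ (aeval_single_surj g hg) _ _ _ ((omegaMinus_monic p n).map _).ne_zero hW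
      (aeval_single_ker g hg)
  have h2 : ∀ a : AddMonoidAlgebra O (ZMod (p ^ n)),
      a * Polynomial.aeval (AddMonoidAlgebra.single g (1 : O)) (omegaPlus p n) = 0 ↔
        a ∈ Ideal.span
          {Polynomial.aeval (AddMonoidAlgebra.single g (1 : O)) (omegaMinus p n)} := by
    rw [key, key]
    exact ann_of_poly _ (aeval_single_surj g hg) _ _ _ ((omegaPlus_monic p n).map _).ne_zero
      ((mul_comm _ _).trans hW) (aeval_single_ker g hg)
  exact ⟨h1, h2, quot_equiv_span _ _ h1, quot_equiv_span _ _ h2⟩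
end

section
/- Let p be a prime and Λ = ℤ_p[[X]] the power series ring over the p-adic integers. Let M be a finitely generated torsion Λ-module (i.e. its annihilator is nonzero) which has no nonzero finite Λ-submodule (every nonzero Λ-submodule of M is infinite as a set). Then M has projective dimension at most 1 over Λ: there exist an integer r ≥ 0 and an injective Λ-linear map Λ^r → Λ^r whose cokernel is isomorphic to M, i.e. a short exact sequence 0 → Λ^r → Λ^r → M → 0. -/
open PowerSeries in
lemma aux_X_sub_mem {p : ℕ} [Fact p.Prime] (P : Ideal (PowerSeries ℤ_[p])) (hP : P.IsPrime)
    {i j : ℕ} (hij : i < j)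
    (hi : (X - C ((p : ℤ_[p]) ^ (i + 1)) : PowerSeries ℤ_[p]) ∈ P)
    (hj : (X - C ((p : ℤ_[p]) ^ (j + 1)) : PowerSeries ℤ_[p]) ∈ P) :
    (X : PowerSeries ℤ_[p]) ∈ P ∧ (C (p : ℤ_[p]) : PowerSeries ℤ_[p]) ∈ P := by
  obtain ⟨d, rfl⟩ := Nat.exists_eq_add_of_lt hij
  have h1 : (C (p : ℤ_[p]) : PowerSeries ℤ_[p]) ^ (i + 1) *
      (C (1 - (p : ℤ_[p]) ^ (d + 1))) ∈ P := by
    have := P.sub_mem hj hi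
    convert this using 1
    simp only [map_sub, map_pow, map_one]
    ring
  have hp : (C (p : ℤ_[p]) : PowerSeries ℤ_[p]) ∈ P := by
    rcases hP.mem_or_mem h1 with h | h
    · exact hP.mem_of_pow_mem _ h
    · exfalso
      apply hP.ne_top
      refine Ideal.eq_top_of_isUnit_mem _ h (IsUnit.map C ?_)
      refine (IsLocalRing.isUnit_or_isUnit_of_add_one (a := 1 - (p : ℤ_[p]) ^ (d + 1))
        (b := (p : ℤ_[p]) ^ (d + 1)) (by ring)).resolve_right ?_
      intro hu
      exact PadicInt.prime_p.not_isUnit (isUnit_pow_iff (by omega) |>.1 hu)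
  refine ⟨?_, hp⟩
  have := P.add_mem hi (P.mul_mem_right ((C (p : ℤ_[p])) ^ i) hp)
  convert this using 1
  simp only [map_pow]
  ring

open PowerSeries in
lemma aux_finite_quot {p : ℕ} [Fact p.Prime] (P : Ideal (PowerSeries ℤ_[p]))
    (hX : (X : PowerSeries ℤ_[p]) ∈ P) (hp : (C (p : ℤ_[p]) : PowerSeries ℤ_[p]) ∈ P) :
    Finite (PowerSeries ℤ_[p] ⧸ P) := by
  refine Finite.of_surjective
    (fun n : Fin p => Ideal.Quotient.mk P (C ((n : ℕ) : ℤ_[p]))) ?_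
  intro y
  obtain ⟨g, rfl⟩ := Ideal.Quotient.mk_surjective y
  obtain ⟨n, hn, hm⟩ := PadicInt.exists_mem_range (constantCoeff g)
  refine ⟨⟨n, hn⟩, ?_⟩
  symm
  rw [Ideal.Quotient.eq]
  rw [PadicInt.maximalIdeal_eq_span_p, Ideal.mem_span_singleton] at hm
  obtain ⟨b, hb⟩ := hm
  have h1 : (X : PowerSeries ℤ_[p]) ∣ g - C (constantCoeff g) := by
    rw [X_dvd_iff]; simp
  obtain ⟨h, hh⟩ := h1
  have : g - C ((n : ℕ) : ℤ_[p]) = X * h + C (p : ℤ_[p]) * C b := by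
    rw [← hh, ← map_mul, ← hb, map_sub]; ring
  simp only [this]
  exact P.add_mem (P.mul_mem_right _ hX) (P.mul_mem_right _ hp)

open PowerSeries in
lemma aux_regular (p : ℕ) [Fact p.Prime] (M : Type*) [AddCommGroup M]
    [Module (PowerSeries ℤ_[p]) M] [Module.Finite (PowerSeries ℤ_[p]) M]
    (hfin : ∀ N : Submodule (PowerSeries ℤ_[p]) M, N ≠ ⊥ → Set.Infinite (N : Set M)) :
    ∃ k : ℕ, IsSMulRegular M (X - C ((p : ℤ_[p]) ^ (k + 1)) : PowerSeries ℤ_[p]) := by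
  by_contra! hcon
  have hmem : ∀ k : ℕ, ∃ P : associatedPrimes (PowerSeries ℤ_[p]) M,
      (X - C ((p : ℤ_[p]) ^ (k + 1)) : PowerSeries ℤ_[p]) ∈ (P : Ideal _) := by
    intro k
    have h : (X - C ((p : ℤ_[p]) ^ (k + 1)) : PowerSeries ℤ_[p]) ∈
        (⋃ P ∈ associatedPrimes (PowerSeries ℤ_[p]) M, (P : Set (PowerSeries ℤ_[p]))) := by
      rw [biUnion_associatedPrimes_eq_compl_regular]
      exact hcon k
    simp only [Set.mem_iUnion] at h
    obtain ⟨P, hP, hx⟩ := h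
    exact ⟨⟨P, hP⟩, hx⟩
  choose F hF using hmem
  have : Finite (associatedPrimes (PowerSeries ℤ_[p]) M) :=
    (associatedPrimes.finite (PowerSeries ℤ_[p]) M).to_subtype
  obtain ⟨i, j, hij, he⟩ := Finite.exists_ne_map_eq_of_infinite F
  have key : ∀ i j : ℕ, i < j → F i = F j → False := by
    intro i j hij he
    have hass : IsAssociatedPrime (F i : Ideal (PowerSeries ℤ_[p])) M := (F i).2
    obtain ⟨h1, h2⟩ := aux_X_sub_mem (F i).1 hass.isPrime hij (hF i) (he ▸ hF j)
    have hf := aux_finite_quot _ h1 h2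
    obtain ⟨hprime, f, hinj⟩ := (isAssociatedPrime_iff_exists_injective_linearMap _ _).1 hass
    refine hfin (LinearMap.range f) ?_ ?_
    · intro h0
      rw [LinearMap.range_eq_bot] at h0
      apply hprime.ne_top
      rw [← Ideal.Quotient.subsingleton_iff]
      exact ⟨fun a b => hinj (by simp [h0])⟩
    · rw [LinearMap.coe_range]
      exact Set.finite_range f
  rcases lt_or_gt_of_ne hij with h | h
  · exact key _ _ h he
  · exact key _ _ h he.symm

lemma aux_quot (p : ℕ) [Fact p.Prime] (k : ℕ) :
    Nonempty ((PowerSeries ℤ_[p] ⧸ Ideal.span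
      {(PowerSeries.X - PowerSeries.C ((p : ℤ_[p]) ^ (k + 1)) : PowerSeries ℤ_[p])}) ≃+* ℤ_[p]) := by
  have hd : (Polynomial.X - Polynomial.C ((p : ℤ_[p]) ^ (k + 1))).IsDistinguishedAt
      (IsLocalRing.maximalIdeal ℤ_[p]) := by
    refine ⟨⟨?_⟩, Polynomial.monic_X_sub_C _⟩
    intro n hn
    rw [Polynomial.natDegree_X_sub_C] at hn
    obtain rfl : n = 0 := by omega
    rw [PadicInt.maximalIdeal_eq_span_p, Ideal.mem_span_singleton]
    simp [pow_succ]
  have e1 := hd.algEquivQuotient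
  have e2 := Polynomial.quotientSpanXSubCAlgEquiv ((p : ℤ_[p]) ^ (k + 1))
  have e3 := (e1.symm.trans e2).toRingEquiv
  have h : ((Polynomial.X - Polynomial.C ((p : ℤ_[p]) ^ (k + 1)) : Polynomial ℤ_[p]) :
      PowerSeries ℤ_[p]) = PowerSeries.X - PowerSeries.C ((p : ℤ_[p]) ^ (k + 1)) := by
    rw [Polynomial.coe_sub, Polynomial.coe_X, Polynomial.coe_C]
  rw [← h]
  exact ⟨e3⟩

open PowerSeries in
theorem torsion_module_pd_le_one (p : ℕ) [Fact p.Prime] (M : Type*) [AddCommGroup M]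
    [Module (PowerSeries ℤ_[p]) M] [Module.Finite (PowerSeries ℤ_[p]) M]
    (htor : Module.annihilator (PowerSeries ℤ_[p]) M ≠ ⊥)
    (hfin : ∀ N : Submodule (PowerSeries ℤ_[p]) M, N ≠ ⊥ → Set.Infinite (N : Set M)) :
    ∃ (r : ℕ)
      (f : (Fin r → PowerSeries ℤ_[p]) →ₗ[PowerSeries ℤ_[p]] (Fin r → PowerSeries ℤ_[p])),
      Function.Injective f ∧
      Nonempty (((Fin r → PowerSeries ℤ_[p]) ⧸ LinearMap.range f)
        ≃ₗ[PowerSeries ℤ_[p]] M) := by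
  obtain ⟨k, hreg⟩ := aux_regular p M hfin
  obtain ⟨e⟩ := aux_quot p k
  set π : PowerSeries ℤ_[p] := X - C ((p : ℤ_[p]) ^ (k + 1)) with hπ
  obtain ⟨n, g, hg⟩ := Module.Finite.exists_fin' (PowerSeries ℤ_[p]) M
  have hdom : IsDomain (PowerSeries ℤ_[p] ⧸ Ideal.span {π}) := e.toMulEquiv.isDomain _
  have hpir : IsPrincipalIdealRing (PowerSeries ℤ_[p] ⧸ Ideal.span {π}) :=
    IsPrincipalIdealRing.of_surjective e.symm.toRingHom e.symm.surjective
  have hπ0 : π ≠ 0 := by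
    intro h
    have := congrArg (PowerSeries.coeff 1) h
    rw [hπ, map_sub, PowerSeries.coeff_one_X, PowerSeries.coeff_C] at this
    simp at this
  have hjac : π ∈ (⊥ : Ideal (PowerSeries ℤ_[p])).jacobson := by
    rw [IsLocalRing.jacobson_eq_maximalIdeal _ bot_ne_top, IsLocalRing.mem_maximalIdeal,
      mem_nonunits_iff, PowerSeries.isUnit_iff_constantCoeff]
    simp only [hπ, map_sub, constantCoeff_X, constantCoeff_C, zero_sub, IsUnit.neg_iff]
    intro hu
    exact PadicInt.prime_p.not_isUnit (isUnit_pow_iff (by omega) |>.1 hu)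
  set K := LinearMap.ker g with hK
  have hinj : Function.Injective (QuotSMulTop.map π K.subtype) := by
    rw [injective_iff_map_eq_zero]
    intro a ha
    obtain ⟨x, rfl⟩ := Submodule.Quotient.mk_surjective _ a
    rw [QuotSMulTop.map_apply_mk, Submodule.Quotient.mk_eq_zero,
      Submodule.mem_smul_pointwise_iff_exists] at ha
    obtain ⟨y, -, hy⟩ := ha
    have hgy : g y = 0 := by
      apply hreg.right_eq_zero_of_smul
      rw [← map_smul, hy]
      exact x.2
    rw [Submodule.Quotient.mk_eq_zero, Submodule.mem_smul_pointwise_iff_exists]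
    exact ⟨⟨y, hgy⟩, trivial, Subtype.ext hy⟩
  have hKfree : Module.Free (PowerSeries ℤ_[p]) K := by
    have hKreg : IsSMulRegular K π := by
      intro a b hab
      exact smul_right_injective K hπ0 hab
    have : Module.FinitePresentation (PowerSeries ℤ_[p]) K :=
      Module.finitePresentation_of_finite _ _
    rw [← Module.free_quotSMulTop_iff_free _ _ hjac hKreg]
    let h' := (QuotSMulTop.map π K.subtype).extendScalarsOfSurjective
      (S := PowerSeries ℤ_[p] ⧸ Ideal.span {π}) Ideal.Quotient.mk_surjective
    have hinj' : Function.Injective h' := hinj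
    have : Module.IsTorsionFree (PowerSeries ℤ_[p] ⧸ Ideal.span {π}) (QuotSMulTop π K) :=
      hinj'.moduleIsTorsionFree _ (fun _ _ => map_smul _ _ _)
    have := Module.Finite.of_restrictScalars_finite (PowerSeries ℤ_[p])
      (PowerSeries ℤ_[p] ⧸ Ideal.span {π}) (QuotSMulTop π K)
    infer_instance
  have hrank : Module.finrank (PowerSeries ℤ_[p]) K = n := by
    have h1 := Submodule.finrank_quotient_add_finrank K
    have h2 : Module.finrank (PowerSeries ℤ_[p]) M = 0 := by
      rw [Module.finrank_eq_zero_iff_isTorsion]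
      obtain ⟨a, ha, ha0⟩ := Submodule.exists_mem_ne_zero_of_ne_bot htor
      intro x
      exact ⟨⟨a, mem_nonZeroDivisors_of_ne_zero ha0⟩, Module.mem_annihilator.1 ha x⟩
    rw [(g.quotKerEquivOfSurjective hg).finrank_eq, h2] at h1
    simpa using h1
  let b := Module.finBasisOfFinrankEq (PowerSeries ℤ_[p]) K hrank
  refine ⟨n, K.subtype ∘ₗ b.equivFun.symm.toLinearMap, ?_, ⟨?_⟩⟩
  · exact K.injective_subtype.comp b.equivFun.symm.injective
  · refine (Submodule.quotEquivOfEq _ _ ?_).trans (g.quotKerEquivOfSurjective hg)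
    rw [LinearMap.range_comp, LinearEquiv.range, Submodule.map_top, Submodule.range_subtype]
end
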